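/- Let c and d be square-free integers, both distinct and not equal to 1, and set c₁ = c / gcd(c, d) and d₁ = d / gcd(c, d). Then the polynomial f(x) = (x² − c)(x² − d)(x² − c₁d₁) has a root modulo every positive integer if and only if: (1) for each odd prime p dividing c, either (d/p) = +1 or (c₁d₁/p) = +1, and for each odd prime p dividing d, either (c/p) = +1 or (c₁d₁/p) = +1; and (2) at least one of c, d, and c₁d₁ is of the form 8m + 1 for some nonzero integer m. -/

import Mathlib

theorem Prime.pow_succ_dvd_or_pow_succ_dvd {p : ℤ} (hp : Prime p) (a b : ℕ) (u v : ℤ)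
    (h : p ^ (a + b + 1) ∣ u * v) : p ^ (a + 1) ∣ u ∨ p ^ (b + 1) ∣ v := by
  induction a generalizing u with
  | zero =>
    by_cases hu : p ∣ u
    · left; simpa using hu
    · right
      have := hp.pow_dvd_of_dvd_mul_left _ hu h
      simpa using this
  | succ a ih =>
    by_cases hu : p ∣ u
    · obtain ⟨w, rfl⟩ := hu
      have h' : p ^ (a + b + 1) ∣ w * v := by
        have h2 : p * p ^ (a + b + 1) ∣ p * (w * v) := by
          convert h using 1 <;> ring
        exact (mul_dvd_mul_iff_left hp.ne_zero).mp h2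
      rcases ih w h' with h3 | h3
      · left
        rw [pow_succ' p (a + 1)]
        exact mul_dvd_mul_left p h3
      · exact Or.inr h3
    · right
      have := hp.pow_dvd_of_dvd_mul_left _ hu h
      exact (pow_dvd_pow p (by omega)).trans this

theorem Squarefree.not_sq_dvd_sq_sub {p a : ℤ} (hp : Prime p) (ha : Squarefree a)
    (hpa : p ∣ a) (x : ℤ) : ¬ p ^ 2 ∣ x ^ 2 - a := by
  intro h
  have h1 : p ∣ x ^ 2 := by
    have h2 : p ∣ x ^ 2 - a := (dvd_pow_self p two_ne_zero).trans h
    simpa using dvd_add h2 hpa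
  have h3 : p ^ 2 ∣ x ^ 2 := pow_dvd_pow_of_dvd (hp.dvd_of_dvd_pow h1) 2
  have h4 : p ^ 2 ∣ a := by simpa using dvd_sub h3 h
  exact hp.not_isUnit (ha p (by rwa [← sq]))

theorem Squarefree.prime_dvd_sq_sub {p a b : ℤ} (hp : Prime p) (ha : Squarefree a)
    (hb : Squarefree b) (hpa : p ∣ a) (hpb : p ∣ b) {x w : ℤ}
    (h : p ^ 3 ∣ (x ^ 2 - a) * (x ^ 2 - b) * w) : p ∣ w := by
  rcases hp.pow_succ_dvd_or_pow_succ_dvd 2 0 _ _ h with h1 | h1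
  · rcases hp.pow_succ_dvd_or_pow_succ_dvd 1 1 _ _ h1 with h2 | h2
    · exact absurd h2 (ha.not_sq_dvd_sq_sub hp hpa x)
    · exact absurd h2 (hb.not_sq_dvd_sq_sub hp hpb x)
  · simpa using h1

theorem Squarefree.emod_eight_eq_one {a x : ℤ} (ha : Squarefree a) (h : 8 ∣ x ^ 2 - a) :
    a % 8 = 1 := by
  rcases Int.even_or_odd x with ⟨y, rfl⟩ | hx
  · have h4 : (2 : ℤ) * 2 ∣ a := by
      have h1 : (4 : ℤ) ∣ (y + y) ^ 2 := ⟨y ^ 2, by ring⟩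
      have h2 : (4 : ℤ) ∣ (y + y) ^ 2 - a := (by norm_num : (4 : ℤ) ∣ 8).trans h
      simpa using dvd_sub h1 h2
    exact absurd (ha 2 h4) Int.prime_two.not_isUnit
  · have := Int.eight_dvd_sq_sub_one_of_odd hx
    omega

theorem legendreSym.eq_one_iff_exists_dvd (p : ℕ) [Fact p.Prime] (a : ℤ) :
    legendreSym p a = 1 ↔ ¬ (p : ℤ) ∣ a ∧ ∃ x : ℤ, (p : ℤ) ∣ x ^ 2 - a := by
  by_cases h0 : (p : ℤ) ∣ a
  · have : legendreSym p a = 0 :=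
      (legendreSym.eq_zero_iff p a).mpr ((ZMod.intCast_zmod_eq_zero_iff_dvd a p).mpr h0)
    simp [this, h0]
  · have h0' : (a : ZMod p) ≠ 0 := fun h => h0 ((ZMod.intCast_zmod_eq_zero_iff_dvd a p).mp h)
    rw [legendreSym.eq_one_iff p h0']
    simp only [h0, not_false_eq_true, true_and]
    constructor
    · rintro ⟨r, hr⟩
      obtain ⟨x, rfl⟩ := ZMod.intCast_surjective r
      refine ⟨x, (ZMod.intCast_zmod_eq_zero_iff_dvd _ p).mp ?_⟩
      push_cast
      rw [hr]; ring
    · rintro ⟨x, hx⟩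
      refine ⟨(x : ZMod p), ?_⟩
      have := (ZMod.intCast_zmod_eq_zero_iff_dvd _ p).mpr hx
      push_cast at this
      rw [← sq]
      exact (sub_eq_zero.mp this).symm

theorem exists_pow_dvd_sq_sub_of_odd {p a : ℤ} (hp : Prime p) (hp2 : ¬ p ∣ 2) (hpa : ¬ p ∣ a)
    (h : ∃ x : ℤ, p ∣ x ^ 2 - a) (k : ℕ) : ∃ x : ℤ, p ^ k ∣ x ^ 2 - a := by
  suffices H : ∀ k : ℕ, ∃ x : ℤ, p ^ (k + 1) ∣ x ^ 2 - a by
    obtain ⟨x, hx⟩ := H k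
    exact ⟨x, (pow_dvd_pow p k.le_succ).trans hx⟩
  intro k
  induction k with
  | zero => simpa using h
  | succ k ih =>
    obtain ⟨x, s, hs⟩ := ih
    have hx : ¬ p ∣ 2 * x := by
      intro h2
      have hpx := (hp.dvd_or_dvd h2).resolve_left hp2
      apply hpa
      have h3 : p ∣ x ^ 2 := dvd_pow hpx two_ne_zero
      have h4 : p ∣ x ^ 2 - a := by
        exact hs ▸ (dvd_pow_self p k.succ_ne_zero).mul_right s
      simpa using dvd_sub h3 h4
    obtain ⟨u, v, huv⟩ := (Prime.coprime_iff_not_dvd hp).mpr hx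
    refine ⟨x - s * v * p ^ (k + 1), s * u + s ^ 2 * v ^ 2 * p ^ k, ?_⟩
    linear_combination hs - s * p ^ (k + 1) * huv

theorem exists_two_pow_dvd_sq_sub {a : ℤ} (ha : a % 8 = 1) (k : ℕ) :
    ∃ x : ℤ, 2 ^ k ∣ x ^ 2 - a := by
  suffices H : ∀ k : ℕ, ∃ x : ℤ, Odd x ∧ 2 ^ (k + 3) ∣ x ^ 2 - a by
    obtain ⟨x, -, hx⟩ := H k
    exact ⟨x, (pow_dvd_pow 2 (by omega)).trans hx⟩
  intro k
  induction k with
  | zero => exact ⟨1, odd_one, by norm_num; omega⟩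
  | succ k ih =>
    obtain ⟨x, ⟨y, rfl⟩, s, hs⟩ := ih
    refine ⟨2 * y + 1 + s * 2 ^ (k + 2), ⟨y + s * 2 ^ (k + 1), by ring⟩,
      s * (1 + y) + s ^ 2 * 2 ^ k, ?_⟩
    linear_combination hs

theorem Polynomial.exists_dvd_eval_mul_of_isCoprime (f : Polynomial ℤ) {m n : ℤ}
    (hmn : IsCoprime m n) (hm : ∃ x, m ∣ f.eval x) (hn : ∃ x, n ∣ f.eval x) :
    ∃ x, m * n ∣ f.eval x := by
  obtain ⟨x, hx⟩ := hm
  obtain ⟨y, hy⟩ := hn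
  obtain ⟨u, v, huv⟩ := hmn
  refine ⟨x * (v * n) + y * (u * m), IsCoprime.mul_dvd ⟨u, v, huv⟩ ?_ ?_⟩
  · have h : m ∣ (x * (v * n) + y * (u * m)) - x :=
      ⟨u * (y - x), by linear_combination x * huv⟩
    simpa using dvd_add (h.trans (f.sub_dvd_eval_sub _ _)) hx
  · have h : n ∣ (x * (v * n) + y * (u * m)) - y :=
      ⟨v * (x - y), by linear_combination y * huv⟩
    simpa using dvd_add (h.trans (f.sub_dvd_eval_sub _ _)) hy

theorem Polynomial.exists_dvd_eval_of_prime_pow (f : Polynomial ℤ)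
    (h : ∀ p k : ℕ, p.Prime → ∃ x, (p : ℤ) ^ k ∣ f.eval x) (m : ℕ) (hm : 0 < m) :
    ∃ x, (m : ℤ) ∣ f.eval x := by
  induction m using Nat.recOnPosPrimePosCoprime with
  | prime_pow p k hp _ => simpa using h p k hp
  | zero => exact absurd hm (lt_irrefl 0)
  | one => exact ⟨0, by simp⟩
  | coprime a b ha hb hab iha ihb =>
    push_cast
    exact f.exists_dvd_eval_mul_of_isCoprime (Nat.isCoprime_iff_coprime.mpr hab)
      (iha (by omega)) (ihb (by omega))

/-- **Corollary 2.** Let `c` and `d` be distinct square-free integers, neither equal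
to `1`, and let `c₁ = c / gcd(c,d)`, `d₁ = d / gcd(c,d)`. Then
`f(x) = (x² - c)(x² - d)(x² - c₁d₁)` has a root modulo every positive integer iff:
(1) for each odd prime `p ∣ c`, `(d/p) = +1` or `(c₁d₁/p) = +1`, and for each odd
prime `p ∣ d`, `(c/p) = +1` or `(c₁d₁/p) = +1`; and
(2) one of `c`, `d`, `c₁d₁` equals `8m + 1` for a nonzero integer `m`. -/
theorem stmt_10 (c d : ℤ) (hsfc : Squarefree c) (hsfd : Squarefree d)
    (hc1 : c ≠ 1) (hd1 : d ≠ 1) (hcd : c ≠ d)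
    (c₁ d₁ : ℤ) (hc₁ : c₁ = c / (Int.gcd c d : ℤ)) (hd₁ : d₁ = d / (Int.gcd c d : ℤ)) :
    (∀ m : ℕ, 0 < m → ∃ x : ℤ,
        (m : ℤ) ∣ (x ^ 2 - c) * (x ^ 2 - d) * (x ^ 2 - c₁ * d₁)) ↔
      ((∀ p : ℕ, ∀ hp : p.Prime, p ≠ 2 →
          ((p : ℤ) ∣ c →
            @legendreSym p ⟨hp⟩ d = 1 ∨ @legendreSym p ⟨hp⟩ (c₁ * d₁) = 1) ∧
          ((p : ℤ) ∣ d →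
            @legendreSym p ⟨hp⟩ c = 1 ∨ @legendreSym p ⟨hp⟩ (c₁ * d₁) = 1)) ∧
        (∃ m : ℤ, m ≠ 0 ∧ (c = 8 * m + 1 ∨ d = 8 * m + 1 ∨ c₁ * d₁ = 8 * m + 1))) := by
  obtain ⟨g, hg⟩ : ∃ g : ℤ, g = (Int.gcd c d : ℤ) := ⟨_, rfl⟩
  rw [← hg] at hc₁ hd₁
  have hc : c = g * c₁ := by
    rw [hc₁, Int.mul_ediv_cancel' (hg ▸ Int.gcd_dvd_left c d)]
  have hd : d = g * d₁ := by
    rw [hd₁, Int.mul_ediv_cancel' (hg ▸ Int.gcd_dvd_right c d)]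
  have hcop : IsCoprime c₁ d₁ := by
    rw [hc₁, hd₁, hg, Int.isCoprime_iff_gcd_eq_one]
    exact Int.gcd_div_gcd_div_gcd (Int.gcd_pos_of_ne_zero_left _ hsfc.ne_zero)
  have hsfe : Squarefree (c₁ * d₁) :=
    (squarefree_mul_iff).mpr ⟨hcop.isRelPrime, hsfc.squarefree_of_dvd ⟨g, by rw [hc]; ring⟩,
      hsfd.squarefree_of_dvd ⟨g, by rw [hd]; ring⟩⟩
  have he1 : c₁ * d₁ ≠ 1 := by
    intro h
    rcases Int.mul_eq_one_iff_eq_one_or_neg_one.mp h with ⟨h1, h2⟩ | ⟨h1, h2⟩ <;>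
      exact hcd (by rw [hc, hd, h1, h2])
  have hcde : c * d = g ^ 2 * (c₁ * d₁) := by rw [hc, hd]; ring
  have hcp : ∀ p : ℤ, Prime p → p ∣ g → ¬ p ∣ c₁ := fun p hp h1 h2 =>
    hp.not_isUnit (hsfc p (hc ▸ mul_dvd_mul h1 h2))
  have hdp : ∀ p : ℤ, Prime p → p ∣ g → ¬ p ∣ d₁ := fun p hp h1 h2 =>
    hp.not_isUnit (hsfd p (hd ▸ mul_dvd_mul h1 h2))
  clear hc₁ hd₁ hg
  have hec : ∀ p : ℤ, Prime p → p ∣ c → ¬ p ∣ d → p ∣ c₁ * d₁ := by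
    intro p hp h1 h2
    have h3 : ¬ p ∣ g := fun h => h2 (hd ▸ h.mul_right _)
    exact ((hp.dvd_or_dvd (hc ▸ h1)).resolve_left h3).mul_right _
  have hed : ∀ p : ℤ, Prime p → p ∣ d → ¬ p ∣ c → p ∣ c₁ * d₁ := by
    intro p hp h1 h2
    have h3 : ¬ p ∣ g := fun h => h2 (hc ▸ h.mul_right _)
    exact ((hp.dvd_or_dvd (hd ▸ h1)).resolve_left h3).mul_left _
  have hecd : ∀ p : ℤ, Prime p → p ∣ c → p ∣ d → ¬ p ∣ c₁ * d₁ := by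
    intro p hp h1 h2 h3
    have hpg : p ∣ g := by
      by_contra h
      exact hp.not_isUnit (hcop.isUnit_of_dvd' ((hp.dvd_or_dvd (hc ▸ h1)).resolve_left h)
        ((hp.dvd_or_dvd (hd ▸ h2)).resolve_left h))
    exact (hp.dvd_or_dvd h3).elim (hcp p hp hpg) (hdp p hp hpg)
  generalize c₁ * d₁ = e at *
  constructor
  · intro H
    refine ⟨fun p hp _ => ?_, ?_⟩
    · have : Fact p.Prime := ⟨hp⟩
      have hpi : Prime (p : ℤ) := Nat.prime_iff_prime_int.mp hp
      obtain ⟨x, hx⟩ := H (p ^ 3) (pow_pos hp.pos 3)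
      push_cast at hx
      simp only [legendreSym.eq_one_iff_exists_dvd]
      have hboth : (p : ℤ) ∣ c → (p : ℤ) ∣ d → ¬ (p : ℤ) ∣ e ∧ ∃ x : ℤ, (p : ℤ) ∣ x ^ 2 - e :=
        fun h1 h2 => ⟨hecd p hpi h1 h2, x, hsfc.prime_dvd_sq_sub hpi hsfd h1 h2 hx⟩
      constructor
      · intro h1
        by_cases h2 : (p : ℤ) ∣ d
        · exact Or.inr (hboth h1 h2)
        · exact Or.inl ⟨h2, x, hsfc.prime_dvd_sq_sub hpi hsfe h1 (hec p hpi h1 h2)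
            (by rwa [mul_right_comm] at hx)⟩
      · intro h1
        by_cases h2 : (p : ℤ) ∣ c
        · exact Or.inr (hboth h2 h1)
        · refine Or.inl ⟨h2, x, hsfd.prime_dvd_sq_sub hpi hsfe h1 (hed p hpi h1 h2) (x := x) ?_⟩
          convert hx using 1
          ring
    · obtain ⟨x, hx⟩ := H (2 ^ 7) (by norm_num)
      push_cast at hx
      have key : c % 8 = 1 ∨ d % 8 = 1 ∨ e % 8 = 1 := by
        rcases Int.prime_two.pow_succ_dvd_or_pow_succ_dvd 4 2 _ _ hx with h1 | h1
        · rcases Int.prime_two.pow_succ_dvd_or_pow_succ_dvd 2 2 _ _ h1 with h2 | h2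
          · exact Or.inl (hsfc.emod_eight_eq_one h2)
          · exact Or.inr (Or.inl (hsfd.emod_eight_eq_one h2))
        · exact Or.inr (Or.inr (hsfe.emod_eight_eq_one h1))
      rcases key with h | h | h
      · exact ⟨c / 8, by omega, by omega⟩
      · exact ⟨d / 8, by omega, by omega⟩
      · exact ⟨e / 8, by omega, by omega⟩
  · rintro ⟨H1, m, -, H2⟩
    have hloc : ∀ p k : ℕ, p.Prime → ∃ x : ℤ, (p : ℤ) ^ k ∣ x ^ 2 - c ∨
        (p : ℤ) ^ k ∣ x ^ 2 - d ∨ (p : ℤ) ^ k ∣ x ^ 2 - e := by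
      intro p k hp
      by_cases hp2 : p = 2
      · subst hp2
        rcases H2 with h | h | h
        · obtain ⟨x, hx⟩ := exists_two_pow_dvd_sq_sub (a := c) (by omega) k
          exact ⟨x, Or.inl hx⟩
        · obtain ⟨x, hx⟩ := exists_two_pow_dvd_sq_sub (a := d) (by omega) k
          exact ⟨x, Or.inr (Or.inl hx)⟩
        · obtain ⟨x, hx⟩ := exists_two_pow_dvd_sq_sub (a := e) (by omega) k
          exact ⟨x, Or.inr (Or.inr hx)⟩
      · have : Fact p.Prime := ⟨hp⟩
        have hpi : Prime (p : ℤ) := Nat.prime_iff_prime_int.mp hp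
        have hpt : ¬ (p : ℤ) ∣ 2 := by
          intro h
          exact hp2 ((Nat.prime_dvd_prime_iff_eq hp Nat.prime_two).mp (by exact_mod_cast h))
        have lift : ∀ a : ℤ, legendreSym p a = 1 → ∃ x : ℤ, (p : ℤ) ^ k ∣ x ^ 2 - a := by
          intro a ha
          rw [legendreSym.eq_one_iff_exists_dvd] at ha
          exact exists_pow_dvd_sq_sub_of_odd hpi hpt ha.1 ha.2 k
        have hone : legendreSym p c = 1 ∨ legendreSym p d = 1 ∨ legendreSym p e = 1 := by
          obtain ⟨h1, h2⟩ := H1 p hp hp2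
          by_cases hpc : (p : ℤ) ∣ c
          · exact Or.inr (h1 hpc)
          by_cases hpd : (p : ℤ) ∣ d
          · exact (h2 hpd).imp_right Or.inr
          have hpcd : ¬ (p : ℤ) ∣ g ^ 2 * e := hcde ▸ hpi.not_dvd_mul hpc hpd
          have unit : ∀ a : ℤ, ¬ (p : ℤ) ∣ a → (a : ZMod p) ≠ 0 := fun a h h' =>
            h ((ZMod.intCast_zmod_eq_zero_iff_dvd a p).mp h')
          have hpg : ¬ (p : ℤ) ∣ g := fun h => hpcd ((dvd_pow h two_ne_zero).mul_right _)
          have hmul := congrArg (legendreSym p) hcde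
          rw [legendreSym.mul, legendreSym.mul, legendreSym.sq_one' p (unit g hpg), one_mul] at hmul
          rcases legendreSym.eq_one_or_neg_one p (unit c hpc) with h | h
          · exact Or.inl h
          rcases legendreSym.eq_one_or_neg_one p (unit d hpd) with h' | h'
          · exact Or.inr (Or.inl h')
          rw [h, h'] at hmul
          exact Or.inr (Or.inr (by rw [← hmul]; norm_num))
        rcases hone with h | h | h
        · obtain ⟨x, hx⟩ := lift _ h
          exact ⟨x, Or.inl hx⟩
        · obtain ⟨x, hx⟩ := lift _ h
          exact ⟨x, Or.inr (Or.inl hx)⟩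
        · obtain ⟨x, hx⟩ := lift _ h
          exact ⟨x, Or.inr (Or.inr hx)⟩
    let f : Polynomial ℤ := (.X ^ 2 - .C c) * (.X ^ 2 - .C d) * (.X ^ 2 - .C e)
    have hf : ∀ x, f.eval x = (x ^ 2 - c) * (x ^ 2 - d) * (x ^ 2 - e) := fun x => by simp [f]
    intro m hm
    simp only [← hf]
    refine f.exists_dvd_eval_of_prime_pow (fun p k hp => ?_) m hm
    obtain ⟨x, h⟩ := hloc p k hp
    refine ⟨x, ?_⟩
    rw [hf]
    rcases h with h | h | h
    · exact (h.mul_right _).mul_right _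
    · exact (h.mul_left _).mul_right _
    · exact h.mul_left _
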